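/- arXiv:1002.4711 — 6 statements merged into one kernel-verified Lean document; each statement's English description precedes it below -/
import Mathlib

section
/- Let A be a unital C*-algebra and a, b ∈ A. (1) If a is positive and b is self-adjoint, then the following are equivalent: (i) ab + ba = 0; (ii) ab = 0; (iii) ba = 0. (2) If a is positive and b ∈ A is arbitrary, then ab + ba = 0 if and only if ab = 0 and ba = 0. -/
/-- An element that commutes with the square of a positive element `a` commutes with `a`. -/
theorem commute_of_commute_mul_self {A : Type*} [CStarAlgebra A] [PartialOrder A]
    [StarOrderedRing A] {a b : A} (ha : 0 ≤ a) (h : Commute (a * a) b) : Commute a b := by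
  have h' := h.cfcₙ_nnreal NNReal.sqrt
  change Commute (CFC.sqrt (a * a)) b at h'
  rwa [CFC.sqrt_mul_self a ha] at h'

/-- If a positive element `a` anticommutes with `b`, then `a * b = 0`. -/
theorem mul_eq_zero_of_anticommute {A : Type*} [CStarAlgebra A] [PartialOrder A]
    [StarOrderedRing A] {a b : A} (ha : 0 ≤ a) (h : a * b + b * a = 0) : a * b = 0 := by
  have hab : a * b = -(b * a) := eq_neg_of_add_eq_zero_left h
  have hsq : Commute (a * a) b := by
    change a * a * b = b * (a * a)
    rw [mul_assoc, hab, mul_neg, ← mul_assoc, hab, neg_mul, neg_neg, mul_assoc]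
  have hc : a * b = b * a := commute_of_commute_mul_self ha hsq
  rw [← hc, ← two_smul ℂ] at h
  exact (smul_eq_zero.mp h).resolve_left two_ne_zero


/-- In a unital C*-algebra `A`, for `a` positive:
(1) if `b` is self-adjoint then `ab + ba = 0`, `ab = 0` and `ba = 0` are equivalent;
(2) for arbitrary `b`, `ab + ba = 0` iff `ab = 0` and `ba = 0`. -/
theorem stmt_0 {A : Type*} [CStarAlgebra A] [PartialOrder A] [StarOrderedRing A]
    (a b : A) (ha : 0 ≤ a) :
    (IsSelfAdjoint b →
      ((a * b + b * a = 0 ↔ a * b = 0) ∧ (a * b = 0 ↔ b * a = 0))) ∧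
    (a * b + b * a = 0 ↔ (a * b = 0 ∧ b * a = 0)) := by
  have key : a * b + b * a = 0 ↔ (a * b = 0 ∧ b * a = 0) := by
    refine ⟨fun h => ?_, fun ⟨h₁, h₂⟩ => by rw [h₁, h₂, add_zero]⟩
    have hab := mul_eq_zero_of_anticommute ha h
    exact ⟨hab, by rwa [hab, zero_add] at h⟩
  refine ⟨fun hb => ?_, key⟩
  have hstar : a * b = 0 ↔ b * a = 0 := by
    rw [← star_eq_zero, star_mul, hb.star_eq, (IsSelfAdjoint.of_nonneg ha).star_eq]
  exact ⟨⟨fun h => (key.mp h).1, fun h => key.mpr ⟨h, hstar.mp h⟩⟩, hstar⟩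
end

section
/- Let A be a C*-algebra and S ⊆ A₊. Then Ann(S) and Ann(Ann(S)) are C*-subalgebras of A (i.e. norm-closed *-subalgebras), and for every x ∈ Ann(S) one has xAx ⊆ Ann(S), and for every y ∈ Ann(Ann(S)) one has yAy ⊆ Ann(Ann(S)). -/
/-- The annihilator of a set `S` in an algebra: elements anticommuting with every member of `S`. -/
def Ann {A : Type*} [NonUnitalNonAssocRing A] (S : Set A) : Set A :=
  {a : A | ∀ s ∈ S, a * s + s * a = 0}

/-- In a C*-algebra, elements anticommuting with a positive element annihilate it on both sides. -/
theorem mul_eq_zero_of_anticommute_nonneg {A : Type*} [NonUnitalCStarAlgebra A] [PartialOrder A]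
    [StarOrderedRing A] {a s : A} (hs : 0 ≤ s) (h : a * s + s * a = 0) :
    a * s = 0 ∧ s * a = 0 := by
  have h1 : a * s = -(s * a) := eq_neg_of_add_eq_zero_left h
  have h2 : Commute (s * s) a := by
    change s * s * a = a * (s * s)
    rw [← mul_assoc, h1, neg_mul, mul_assoc s a s, h1, mul_neg, neg_neg, mul_assoc]
  have h3 : Commute s a := by
    have h4 := h2.cfcₙ_nnreal NNReal.sqrt
    change Commute (CFC.sqrt (s * s)) a at h4
    rwa [CFC.sqrt_mul_self s hs] at h4
  have h5 : s * a = 0 := by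
    rw [← h3.eq] at h
    have h6 : (2 : ℂ) • (s * a) = 0 := by rw [two_smul, h]
    exact (smul_eq_zero.mp h6).resolve_left two_ne_zero
  exact ⟨h3.eq ▸ h5, h5⟩

theorem isClosed_Ann {A : Type*} [NonUnitalNonAssocRing A] [TopologicalSpace A] [T1Space A]
    [ContinuousAdd A] [ContinuousMul A] (S : Set A) : IsClosed (Ann S) := by
  simp only [Ann, Set.ofPred_forall]
  refine isClosed_iInter fun s => isClosed_iInter fun _ => ?_
  exact isClosed_singleton.preimage
    (f := fun a : A => a * s + s * a) (by fun_prop)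

/-- When `Ann S` consists of two-sided annihilators of `S`, the products `x * c * x` with
`x ∈ Ann S` stay in `Ann S`. -/
theorem mul_mul_mem_Ann {A : Type*} [NonUnitalRing A] {S : Set A}
    (hS : ∀ a ∈ Ann S, ∀ s ∈ S, a * s = 0 ∧ s * a = 0) {x : A} (hx : x ∈ Ann S) (c : A) :
    x * c * x ∈ Ann S := by
  intro s hs
  obtain ⟨h1, h2⟩ := hS x hx s hs
  rw [mul_assoc, h1, mul_zero, mul_assoc x c x, ← mul_assoc s, h2, zero_mul, add_zero]

/-- The annihilator of a star-closed set, as a star subalgebra, when it consists of two-sided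
annihilators. -/
def annStarSubalgebra {A : Type*} [NonUnitalCStarAlgebra A] (S : Set A)
    (hS : ∀ a ∈ Ann S, ∀ s ∈ S, a * s = 0 ∧ s * a = 0) (hstar : ∀ s ∈ S, star s ∈ S) :
    NonUnitalStarSubalgebra ℂ A where
  carrier := Ann S
  add_mem' {a b} ha hb s hs := by
    rw [add_mul, mul_add, add_add_add_comm, ha s hs, hb s hs, add_zero]
  zero_mem' s _ := by rw [zero_mul, mul_zero, add_zero]
  mul_mem' {a b} ha hb s hs := by
    rw [mul_assoc, (hS b hb s hs).1, ← mul_assoc, (hS a ha s hs).2, mul_zero, zero_mul, add_zero]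
  smul_mem' c a ha s hs := by
    rw [smul_mul_assoc, mul_smul_comm, ← smul_add, ha s hs, smul_zero]
  star_mem' {a} ha s hs := by
    have h := congrArg star (ha (star s) (hstar s hs))
    rwa [star_add, star_mul, star_mul, star_star, star_zero, add_comm] at h

/-- The annihilator of a star subalgebra of a C*-algebra annihilates it on both sides. -/
theorem mul_eq_zero_of_mem_Ann_starSubalgebra {A : Type*} [NonUnitalCStarAlgebra A]
    [PartialOrder A] [StarOrderedRing A] (B : NonUnitalStarSubalgebra ℂ A) {y x : A}
    (hy : y ∈ Ann (B : Set A)) (hx : x ∈ B) : y * x = 0 ∧ x * y = 0 := by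
  have h1 := (mul_eq_zero_of_anticommute_nonneg (mul_star_self_nonneg x)
    (hy _ (mul_mem hx (star_mem hx)))).1
  have h2 := (mul_eq_zero_of_anticommute_nonneg (star_mul_self_nonneg x)
    (hy _ (mul_mem (star_mem hx) hx))).2
  constructor
  · rw [← CStarRing.mul_star_self_eq_zero_iff, star_mul, ← mul_assoc, mul_assoc y, h1, zero_mul]
  · rw [← CStarRing.star_mul_self_eq_zero_iff, star_mul, mul_assoc, ← mul_assoc (star x), h2,
      mul_zero]

/-- For a C*-algebra `A` and `S ⊆ A₊`, both `Ann S` and `Ann (Ann S)` are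
C*-subalgebras of `A` (norm-closed *-subalgebras), `x A x ⊆ Ann S` for `x ∈ Ann S`, and
`y A y ⊆ Ann (Ann S)` for `y ∈ Ann (Ann S)`. -/
theorem stmt_1 {A : Type*} [NonUnitalCStarAlgebra A] [PartialOrder A] [StarOrderedRing A]
    (S : Set A) (hS : ∀ s ∈ S, 0 ≤ s) :
    (∃ B : NonUnitalStarSubalgebra ℂ A, (B : Set A) = Ann S) ∧ IsClosed (Ann S) ∧
    (∃ B : NonUnitalStarSubalgebra ℂ A, (B : Set A) = Ann (Ann S)) ∧ IsClosed (Ann (Ann S)) ∧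
    (∀ x ∈ Ann S, ∀ c : A, x * c * x ∈ Ann S) ∧
    (∀ y ∈ Ann (Ann S), ∀ c : A, y * c * y ∈ Ann (Ann S)) := by
  have h1 : ∀ a ∈ Ann S, ∀ s ∈ S, a * s = 0 ∧ s * a = 0 := fun a ha s hs =>
    mul_eq_zero_of_anticommute_nonneg (hS s hs) (ha s hs)
  have hstar : ∀ s ∈ S, star s ∈ S := fun s hs => by
    rwa [(IsSelfAdjoint.of_nonneg (hS s hs)).star_eq]
  let B := annStarSubalgebra S h1 hstar
  have h2 : ∀ y ∈ Ann (Ann S), ∀ x ∈ Ann S, y * x = 0 ∧ x * y = 0 := fun y hy x hx =>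
    mul_eq_zero_of_mem_Ann_starSubalgebra B hy hx
  exact ⟨⟨B, rfl⟩, isClosed_Ann S,
    ⟨annStarSubalgebra (Ann S) h2 fun x hx => B.star_mem' hx, rfl⟩, isClosed_Ann (Ann S),
    fun _ hx c => mul_mul_mem_Ann h1 hx c, fun _ hy c => mul_mul_mem_Ann h2 hy c⟩
end

section
/- Let A be a C*-algebra and S ⊆ A₊. Then the annihilator of the union Ann(Ann(S)) ∪ (ᵈ(Ann(Ann(S))) ∩ ᵈ(Ann(S))) ∪ Ann(S) is {0}; that is, if a ∈ A satisfies ax + xa = 0 for every x lying in Ann(Ann(S)), in Ann(S), or in ᵈ(Ann(Ann(S))) ∩ ᵈ(Ann(S)), then a = 0. -/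
/-- `ᵈV = {a ∈ A : x a y + y a x = 0 for all x, y ∈ V}`. -/
def dAnn {A : Type*} [NonUnitalNonAssocRing A] (V : Set A) : Set A :=
  {a : A | ∀ x ∈ V, ∀ y ∈ V, x * a * y + y * a * x = 0}

/-- The annihilator of a star-closed set is star-closed. -/
theorem star_mem_Ann {A : Type*} [NonUnitalNonAssocRing A] [StarRing A] {S : Set A}
    (hS : ∀ s ∈ S, star s ∈ S) {a : A} (ha : a ∈ Ann S) : star a ∈ Ann S := by
  intro s hs
  have h := congrArg star (ha (star s) (hS s hs))
  simpa [add_comm] using h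

/-- For a C*-algebra `A` and `S ⊆ A₊`,
`Ann (Ann (Ann S) ∪ (ᵈ(Ann (Ann S)) ∩ ᵈ(Ann S)) ∪ Ann S) = {0}`. -/
theorem stmt_2 {A : Type*} [NonUnitalCStarAlgebra A] [PartialOrder A] [StarOrderedRing A]
    (S : Set A) (hS : ∀ s ∈ S, 0 ≤ s) :
    Ann (Ann (Ann S) ∪ (dAnn (Ann (Ann S)) ∩ dAnn (Ann S)) ∪ Ann S) = {0} := by
  ext a
  rw [Set.mem_singleton_iff]
  constructor
  · intro ha
    have hS_star : ∀ s ∈ S, star s ∈ S := fun s hs ↦ by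
      rwa [(IsSelfAdjoint.of_nonneg (hS s hs)).star_eq]
    have ha_mem : a ∈ Ann (Ann S) := fun b hb ↦ ha b (Or.inr hb)
    have ha_star : star a ∈ Ann (Ann S) :=
      star_mem_Ann (fun _ hb ↦ star_mem_Ann hS_star hb) ha_mem
    have h : a * star a + star a * a = 0 := ha _ (Or.inl (Or.inl ha_star))
    have h_zero := ((add_eq_zero_iff_of_nonneg (mul_star_self_nonneg a)
      (star_mul_self_nonneg a)).mp h).2
    exact (CStarRing.star_mul_self_eq_zero_iff a).mp h_zero
  · rintro rfl s -
    simp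
end

section
/- Let A be a C*-algebra such that for each subset S ⊆ A₊ one has ᵈ(Ann(Ann(S))) ∩ ᵈ(Ann(S)) = {0}. Then for every S ⊆ A₊, the sets Ann(S) and Ann(Ann(S)) are norm-closed two-sided ideals of A. -/
section Annihilators

variable {A : Type*} [NonUnitalCStarAlgebra A]

/-- Commuting and anticommuting elements are orthogonal. -/
lemma mul_eq_zero_of_commute_of_add_eq_zero {a s : A} (hc : Commute a s)
    (h : a * s + s * a = 0) : a * s = 0 := by
  rw [← hc.eq, ← two_smul ℂ] at h
  exact (smul_eq_zero.mp h).resolve_left two_ne_zero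

/-- An element anticommuting with a positive element of a C*-algebra is orthogonal to it. -/
lemma mul_eq_zero_and_mul_eq_zero_of_anticommute [PartialOrder A] [StarOrderedRing A]
    {a s : A} (hs : 0 ≤ s) (h : a * s + s * a = 0) : a * s = 0 ∧ s * a = 0 := by
  have has : a * s = -(s * a) := eq_neg_of_add_eq_zero_left h
  have hsq : Commute (s * s) a := by
    change s * s * a = a * (s * s)
    rw [← mul_assoc, has, neg_mul, mul_assoc s a s, has, mul_neg, neg_neg, mul_assoc]
  have hc : Commute s a := by
    have := hsq.cfcₙ_nnreal NNReal.sqrt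
    rwa [← CFC.sqrt, CFC.sqrt_mul_self s hs] at this
  have h0 := mul_eq_zero_of_commute_of_add_eq_zero hc.symm h
  exact ⟨h0, hc.eq.trans h0⟩

/-- For positive `S`, the set `Ann S` is the two-sided multiplicative annihilator. -/
lemma mem_Ann_iff_of_nonneg [PartialOrder A] [StarOrderedRing A] {S : Set A}
    (hS : ∀ s ∈ S, 0 ≤ s) {a : A} : a ∈ Ann S ↔ ∀ s ∈ S, a * s = 0 ∧ s * a = 0 :=
  ⟨fun ha s hs => mul_eq_zero_and_mul_eq_zero_of_anticommute (hS s hs) (ha s hs),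
    fun ha s hs => by rw [(ha s hs).1, (ha s hs).2, add_zero]⟩

lemma mul_star_self_mem_Ann [PartialOrder A] [StarOrderedRing A] {S : Set A}
    (hS : ∀ s ∈ S, 0 ≤ s) {a : A} (ha : a ∈ Ann S) : a * star a ∈ Ann S := by
  rw [mem_Ann_iff_of_nonneg hS] at ha ⊢
  intro s hs
  have h : star a * s = 0 := by
    simpa [(IsSelfAdjoint.of_nonneg (hS s hs)).star_eq] using congrArg star (ha s hs).2
  rw [mul_assoc, h, mul_zero, ← mul_assoc, (ha s hs).2, zero_mul]
  exact ⟨rfl, rfl⟩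

lemma star_mul_self_mem_Ann [PartialOrder A] [StarOrderedRing A] {S : Set A}
    (hS : ∀ s ∈ S, 0 ≤ s) {a : A} (ha : a ∈ Ann S) : star a * a ∈ Ann S := by
  rw [mem_Ann_iff_of_nonneg hS] at ha ⊢
  intro s hs
  have h : s * star a = 0 := by
    simpa [(IsSelfAdjoint.of_nonneg (hS s hs)).star_eq] using congrArg star (ha s hs).1
  rw [mul_assoc, (ha s hs).1, mul_zero, ← mul_assoc, h, zero_mul]
  exact ⟨rfl, rfl⟩

/-- Elements of `Ann (Ann S)` are orthogonal to those of `Ann S` when `S` is positive. -/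
lemma mem_Ann_Ann_iff_of_nonneg [PartialOrder A] [StarOrderedRing A] {S : Set A}
    (hS : ∀ s ∈ S, 0 ≤ s) {c : A} :
    c ∈ Ann (Ann S) ↔ ∀ b ∈ Ann S, c * b = 0 ∧ b * c = 0 := by
  refine ⟨fun hc b hb => ⟨?_, ?_⟩, fun hc b hb => by rw [(hc b hb).1, (hc b hb).2, add_zero]⟩
  · have h := (mul_eq_zero_and_mul_eq_zero_of_anticommute (mul_star_self_nonneg b)
      (hc _ (mul_star_self_mem_Ann hS hb))).1
    rw [← CStarRing.mul_star_self_eq_zero_iff, star_mul, mul_assoc, ← mul_assoc b, ← mul_assoc, h,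
      zero_mul]
  · have h := (mul_eq_zero_and_mul_eq_zero_of_anticommute (star_mul_self_nonneg b)
      (hc _ (star_mul_self_mem_Ann hS hb))).2
    rw [← CStarRing.star_mul_self_eq_zero_iff, star_mul, mul_assoc, ← mul_assoc (star b), h,
      mul_zero]

lemma subset_Ann_Ann {R : Type*} [NonUnitalNonAssocRing R] (S : Set R) : S ⊆ Ann (Ann S) :=
  fun s hs a ha => by rw [add_comm]; exact ha s hs

lemma isClosed_Ann_s3 (S : Set A) : IsClosed (Ann S) := by
  have : Ann S = ⋂ s ∈ S, {a : A | a * s + s * a = 0} := by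
    ext a
    simp [Ann]
  rw [this]
  exact isClosed_biInter fun s _ => isClosed_eq (by fun_prop) continuous_const

/-- `Ann S` is a two-sided ideal as soon as it is closed under multiplication by `A`. -/
lemma exists_twoSidedIdeal_coe_eq_Ann {R : Type*} [NonUnitalNonAssocRing R] (S : Set R)
    (hl : ∀ x a : R, a ∈ Ann S → x * a ∈ Ann S) (hr : ∀ a x : R, a ∈ Ann S → a * x ∈ Ann S) :
    ∃ I : TwoSidedIdeal R, (I : Set R) = Ann S := by
  refine ⟨TwoSidedIdeal.mk' (Ann S) (fun s _ => by simp) (fun {a b} ha hb s hs => ?_)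
    (fun {a} ha s hs => ?_) (fun {x a} ha => hl x a ha) (fun {a x} ha => hr a x ha),
    TwoSidedIdeal.coe_mk' ..⟩
  · rw [add_mul, mul_add, add_add_add_comm, ha s hs, hb s hs, add_zero]
  · rw [neg_mul, mul_neg, ← neg_add, ha s hs, neg_zero]

/-- If `C B = 0`, then `B A C` lies in both `ᵈB` and `ᵈC`. -/
lemma mul_mul_mem_dAnn_inter {R : Type*} [NonUnitalRing R] {B C : Set R}
    (hCB : ∀ b ∈ B, ∀ c ∈ C, c * b = 0) {b c : R} (hb : b ∈ B) (hc : c ∈ C) (a : R) :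
    b * a * c ∈ dAnn C ∩ dAnn B := by
  refine ⟨fun x hx y hy => ?_, fun x hx y hy => ?_⟩
  · simp only [← mul_assoc, hCB b hb x hx, hCB b hb y hy, zero_mul, add_zero]
  · simp only [mul_assoc, hCB x hx c hc, hCB y hy c hc, mul_zero, add_zero]

end Annihilators

/-- If in a C*-algebra `A` one has `ᵈ(Ann (Ann S)) ∩ ᵈ(Ann S) = {0}` for every
`S ⊆ A₊`, then for every `S ⊆ A₊` the sets `Ann S` and `Ann (Ann S)` are norm-closed two-sided
ideals of `A`. -/
theorem stmt_3 {A : Type*} [NonUnitalCStarAlgebra A] [PartialOrder A] [StarOrderedRing A]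
    (h : ∀ S : Set A, (∀ s ∈ S, 0 ≤ s) → dAnn (Ann (Ann S)) ∩ dAnn (Ann S) = {0})
    (S : Set A) (hS : ∀ s ∈ S, 0 ≤ s) :
    (∃ I : TwoSidedIdeal A, (I : Set A) = Ann S) ∧ IsClosed (Ann S) ∧
    (∃ I : TwoSidedIdeal A, (I : Set A) = Ann (Ann S)) ∧ IsClosed (Ann (Ann S)) := by
  have hAnn := @mem_Ann_iff_of_nonneg A _ _ _ S hS
  have hAnnAnn := @mem_Ann_Ann_iff_of_nonneg A _ _ _ S hS
  have hBC : ∀ b ∈ Ann S, ∀ c ∈ Ann (Ann S), b * c = 0 :=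
    fun b hb c hc => (hAnnAnn.mp hc b hb).2
  have hCB : ∀ b ∈ Ann S, ∀ c ∈ Ann (Ann S), c * b = 0 :=
    fun b hb c hc => (hAnnAnn.mp hc b hb).1
  have hBAC : ∀ b ∈ Ann S, ∀ c ∈ Ann (Ann S), ∀ a, b * a * c = 0 := fun b hb c hc a => by
    simpa [h S hS] using mul_mul_mem_dAnn_inter hCB hb hc a
  have hCAB : ∀ b ∈ Ann S, ∀ c ∈ Ann (Ann S), ∀ a, c * a * b = 0 := fun b hb c hc a => by
    have := mul_mul_mem_dAnn_inter (fun c hc b hb => hBC b hb c hc) hc hb a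
    rw [Set.inter_comm, h S hS] at this
    exact this
  have hSS := subset_Ann_Ann S
  refine ⟨exists_twoSidedIdeal_coe_eq_Ann S (fun x a ha => hAnn.mpr fun s hs => ⟨?_, ?_⟩)
      (fun a x ha => hAnn.mpr fun s hs => ⟨?_, ?_⟩), isClosed_Ann_s3 S,
    exists_twoSidedIdeal_coe_eq_Ann (Ann S) (fun x c hc => hAnnAnn.mpr fun b hb => ⟨?_, ?_⟩)
      (fun c x hc => hAnnAnn.mpr fun b hb => ⟨?_, ?_⟩), isClosed_Ann_s3 (Ann S)⟩
  · rw [mul_assoc, (hAnn.mp ha s hs).1, mul_zero]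
  · rw [← mul_assoc, hCAB a ha s (hSS hs)]
  · exact hBAC a ha s (hSS hs) x
  · rw [← mul_assoc, (hAnn.mp ha s hs).2, zero_mul]
  · rw [mul_assoc, hCB b hb c hc, mul_zero]
  · rw [← mul_assoc, hBAC b hb c hc]
  · exact hCAB b hb c hc x
  · rw [← mul_assoc, hBC b hb c hc, zero_mul]
end

section
/- Let A be a commutative C*-algebra and let X, Y ∈ 𝒫 with X ⊆ Y and X ≠ Y. Then the relative annihilator Ann_Y(X) = {a ∈ Y : as + sa = 0 for all s ∈ X} is nonzero, and Ann_Y(Ann_Y(X)) = X. -/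
/-- The relative annihilator of `S` in `B`: `{a ∈ B | a s + s a = 0 for all s ∈ S}`. -/
def AnnIn {A : Type*} [NonUnitalNonAssocRing A] (B S : Set A) : Set A :=
  {a ∈ B | ∀ s ∈ S, a * s + s * a = 0}

/-- The set `𝒫` of annihilators: sets of the form `Ann (Ann S)` with `S ⊆ A₊`. -/
def PAnn (A : Type*) [NonUnitalNonAssocRing A] [PartialOrder A] : Set (Set A) :=
  {V | ∃ S : Set A, (∀ s ∈ S, 0 ≤ s) ∧ V = Ann (Ann S)}

theorem mem_Ann_iff {A : Type*} [NonUnitalCommCStarAlgebra A] {S : Set A} {a : A} :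
    a ∈ Ann S ↔ ∀ s ∈ S, a * s = 0 := by
  refine forall₂_congr fun s _ => ?_
  rw [mul_comm s a, ← two_smul ℂ (a * s), smul_eq_zero_iff_right two_ne_zero]

theorem mem_AnnIn_iff {A : Type*} [NonUnitalCommCStarAlgebra A] {B S : Set A} {a : A} :
    a ∈ AnnIn B S ↔ a ∈ B ∧ ∀ s ∈ S, a * s = 0 :=
  and_congr_right fun _ => mem_Ann_iff

/-- A commutative C*-algebra has no nonzero elements of square zero. -/
theorem CStarRing.eq_zero_of_mul_self_eq_zero {A : Type*} [NonUnitalCommCStarAlgebra A] {y : A}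
    (h : y * y = 0) : y = 0 := by
  rw [← CStarRing.star_mul_self_eq_zero_iff, ← CStarRing.star_mul_self_eq_zero_iff,
    star_mul, star_star, mul_mul_mul_comm, h, mul_zero]

/-- Inside an annihilator `Ann U`, the relative double annihilator of `Ann T` is `Ann T`. -/
theorem AnnIn_AnnIn_Ann {A : Type*} [NonUnitalCommCStarAlgebra A] {T U : Set A}
    (h : Ann T ⊆ Ann U) : AnnIn (Ann U) (AnnIn (Ann U) (Ann T)) = Ann T := by
  ext a
  rw [mem_AnnIn_iff]
  constructor
  · rintro ⟨haU, ha⟩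
    refine mem_Ann_iff.2 fun t ht => CStarRing.eq_zero_of_mul_self_eq_zero ?_
    have hmem : a * t ∈ AnnIn (Ann U) (Ann T) := by
      refine mem_AnnIn_iff.2 ⟨mem_Ann_iff.2 fun u hu => ?_, fun x hx => ?_⟩
      · rw [mul_right_comm, mem_Ann_iff.1 haU u hu, zero_mul]
      · rw [mul_assoc, mul_comm t, mem_Ann_iff.1 hx t ht, mul_zero]
    rw [mul_right_comm, ha _ hmem, zero_mul]
  · refine fun ha => ⟨h ha, fun b hb => ?_⟩
    rw [mul_comm, (mem_AnnIn_iff.1 hb).2 a ha]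

/-- In a commutative C*-algebra, if `X, Y ∈ 𝒫` with `X ⊆ Y` and `X ≠ Y`, then
`Ann_Y X ≠ {0}` and `Ann_Y (Ann_Y X) = X`. -/
theorem stmt_8 {A : Type*} [NonUnitalCommCStarAlgebra A] [PartialOrder A] [StarOrderedRing A]
    (X Y : Set A) (hX : X ∈ PAnn A) (hY : Y ∈ PAnn A) (hXY : X ⊆ Y) (hne : X ≠ Y) :
    AnnIn Y X ≠ {0} ∧ AnnIn Y (AnnIn Y X) = X := by
  obtain ⟨S, -, rfl⟩ := hX
  obtain ⟨S', -, rfl⟩ := hY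
  have key := AnnIn_AnnIn_Ann hXY
  refine ⟨fun h0 => hne ?_, key⟩
  rw [← key, h0]
  ext a
  simp [mem_AnnIn_iff]
end

section
/- Let A be a C*-algebra. Then the complete lattice 𝒫 of annihilators, with zero {0}, unit A, and the map V ↦ Ann(V) as orthocomplementation, is an ortholattice: for every V ∈ 𝒫 one has V ∧ Ann(V) = {0} and V ∨ Ann(V) = A, Ann(Ann(V)) = V, and for all V, W ∈ 𝒫, Ann(V ∨ W) = Ann(V) ∧ Ann(W) and Ann(V ∧ W) = Ann(V) ∨ Ann(W). -/
/-- `V` is the least upper bound of the family `T` within the collection `P` (ordered by `⊆`). -/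
def IsLUBIn {α : Type*} (P T : Set (Set α)) (V : Set α) : Prop :=
  V ∈ P ∧ (∀ W ∈ T, W ⊆ V) ∧ ∀ U ∈ P, (∀ W ∈ T, W ⊆ U) → V ⊆ U

/-- `V` is the greatest lower bound of the family `T` within the collection `P`. -/
def IsGLBIn {α : Type*} (P T : Set (Set α)) (V : Set α) : Prop :=
  V ∈ P ∧ (∀ W ∈ T, V ⊆ W) ∧ ∀ U ∈ P, (∀ W ∈ T, U ⊆ W) → U ⊆ V

section Galois

variable {A : Type*} [NonUnitalNonAssocRing A]

theorem subset_ann_comm {S T : Set A} : S ⊆ Ann T ↔ T ⊆ Ann S := by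
  constructor <;> intro h x hx y hy <;> rw [add_comm] <;> exact h hy x hx

theorem subset_ann_ann (S : Set A) : S ⊆ Ann (Ann S) :=
  subset_ann_comm.1 subset_rfl

theorem ann_anti {S T : Set A} (h : S ⊆ T) : Ann T ⊆ Ann S :=
  fun _ ha s hs => ha s (h hs)

theorem ann_ann_ann (S : Set A) : Ann (Ann (Ann S)) = Ann S :=
  (ann_anti (subset_ann_ann S)).antisymm (subset_ann_ann (Ann S))

theorem ann_zero : Ann ({0} : Set A) = Set.univ :=
  Set.eq_univ_of_forall fun a => by simp [Ann]

theorem ann_ann_of_mem_pAnn [PartialOrder A] {V : Set A} (hV : V ∈ PAnn A) :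
    Ann (Ann V) = V := by
  obtain ⟨S, -, rfl⟩ := hV
  exact ann_ann_ann _

end Galois

section CStar

variable {A : Type*} [NonUnitalCStarAlgebra A] [PartialOrder A] [StarOrderedRing A]

theorem eq_zero_of_mul_star_add_star_mul_eq_zero {a : A}
    (h : a * star a + star a * a = 0) : a = 0 := by
  have h' := (add_eq_zero_iff_of_nonneg (mul_star_self_nonneg a) (star_mul_self_nonneg a)).1 h
  exact (CStarRing.mul_star_self_eq_zero_iff a).1 h'.1

/-- An element anticommutes with a positive element only if both products vanish. -/
theorem anticommute_nonneg_iff {a s : A} (hs : 0 ≤ s) :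
    a * s + s * a = 0 ↔ a * s = 0 ∧ s * a = 0 := by
  refine ⟨fun h => ?_, fun h => by simp [h.1, h.2]⟩
  have hneg : a * s = -(s * a) := eq_neg_of_add_eq_zero_left h
  have hsq : Commute (s * s) a := by
    change s * s * a = a * (s * s)
    rw [← mul_assoc a, hneg, neg_mul, mul_assoc s a s, hneg, mul_neg, neg_neg, mul_assoc]
  have hcomm : Commute s a := by
    rw [← CFC.sqrt_mul_self s hs]
    exact hsq.cfcₙ_nnreal _
  have hzero : s * a = 0 := by
    rw [← hcomm.eq, ← two_smul ℂ] at h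
    exact (smul_eq_zero.1 h).resolve_left two_ne_zero
  exact ⟨hcomm.eq ▸ hzero, hzero⟩

theorem mem_ann_nonneg_iff {S : Set A} (hS : ∀ s ∈ S, 0 ≤ s) {a : A} :
    a ∈ Ann S ↔ ∀ s ∈ S, a * s = 0 ∧ s * a = 0 :=
  forall₂_congr fun s hs => anticommute_nonneg_iff (hS s hs)

/-- The annihilator of a set of positive elements is determined by its positive elements. -/
theorem ann_nonneg_ann {S : Set A} (hS : ∀ s ∈ S, 0 ≤ s) :
    Ann {a ∈ Ann S | 0 ≤ a} = Ann (Ann S) := by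
  refine Set.Subset.antisymm (fun b hb a ha => ?_) (ann_anti fun a ha => ha.1)
  have hb' := (mem_ann_nonneg_iff fun _ h => h.2).1 hb
  have ha' := (mem_ann_nonneg_iff hS).1 ha
  have hstar : ∀ s ∈ S, star a * s = 0 ∧ s * star a = 0 := fun s hs => by
    have hself : star s = s := (IsSelfAdjoint.of_nonneg (hS s hs)).star_eq
    constructor
    · simpa [hself] using congrArg star (ha' s hs).2
    · simpa [hself] using congrArg star (ha' s hs).1
  have h₁ : b * (a * star a) = 0 := by
    refine (hb' _ ⟨(mem_ann_nonneg_iff hS).2 fun s hs => ⟨?_, ?_⟩, mul_star_self_nonneg a⟩).1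
    · rw [mul_assoc, (hstar s hs).1, mul_zero]
    · rw [← mul_assoc, (ha' s hs).2, zero_mul]
  have h₂ : star a * a * b = 0 := by
    refine (hb' _ ⟨(mem_ann_nonneg_iff hS).2 fun s hs => ⟨?_, ?_⟩, star_mul_self_nonneg a⟩).2
    · rw [mul_assoc, (ha' s hs).1, mul_zero]
    · rw [← mul_assoc, (hstar s hs).2, zero_mul]
  have hba : b * a = 0 := by
    rw [← CStarRing.mul_star_self_eq_zero_iff, star_mul, mul_assoc, ← mul_assoc a, ← mul_assoc,
      h₁, zero_mul]
  have hab : a * b = 0 := by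
    rw [← CStarRing.star_mul_self_eq_zero_iff, star_mul, mul_assoc, ← mul_assoc (star a),
      h₂, mul_zero]
  rw [hba, hab, add_zero]

theorem mem_pAnn_iff {V : Set A} : V ∈ PAnn A ↔ ∃ S : Set A, (∀ s ∈ S, 0 ≤ s) ∧ V = Ann S := by
  constructor
  · rintro ⟨S, hS, rfl⟩
    exact ⟨{a ∈ Ann S | 0 ≤ a}, fun _ h => h.2, (ann_nonneg_ann hS).symm⟩
  · rintro ⟨S, hS, rfl⟩
    exact ⟨{a ∈ Ann S | 0 ≤ a}, fun _ h => h.2, by rw [ann_nonneg_ann hS, ann_ann_ann]⟩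

theorem ann_mem_pAnn {V : Set A} (hV : V ∈ PAnn A) : Ann V ∈ PAnn A := by
  obtain ⟨S, hS, rfl⟩ := mem_pAnn_iff.1 hV
  exact ⟨S, hS, rfl⟩

theorem univ_mem_pAnn : (Set.univ : Set A) ∈ PAnn A :=
  mem_pAnn_iff.2 ⟨{0}, by simp, ann_zero.symm⟩

theorem ann_univ : Ann (Set.univ : Set A) = {0} := by
  refine Set.Subset.antisymm (fun a ha => ?_) ?_
  · exact eq_zero_of_mul_star_add_star_mul_eq_zero (ha (star a) trivial)
  · simp [Ann]

theorem zero_mem_pAnn : ({0} : Set A) ∈ PAnn A :=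
  ann_univ (A := A) ▸ ann_mem_pAnn univ_mem_pAnn

theorem sInter_mem_pAnn {T : Set (Set A)} (hT : T ⊆ PAnn A) : ⋂₀ T ∈ PAnn A := by
  refine mem_pAnn_iff.2 ⟨{s | 0 ≤ s ∧ ∃ V ∈ T, s ∈ Ann V}, fun _ h => h.1, ?_⟩
  refine Set.Subset.antisymm (fun a ha s hs => ?_) (fun a ha V hV => ?_)
  · obtain ⟨-, V, hV, hsV⟩ := hs
    rw [add_comm]
    exact hsV a (ha V hV)
  · obtain ⟨S, hS, rfl⟩ := mem_pAnn_iff.1 (hT hV)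
    exact fun s hs => ha s ⟨hS s hs, _, hV, subset_ann_ann S hs⟩

theorem isGLBIn_sInter {T : Set (Set A)} (hT : T ⊆ PAnn A) : IsGLBIn (PAnn A) T (⋂₀ T) :=
  ⟨sInter_mem_pAnn hT, fun _ hW => Set.sInter_subset_of_mem hW, fun _ _ h => Set.subset_sInter h⟩

theorem IsLUBIn.ann_image {T : Set (Set A)} {V : Set A} (h : IsLUBIn (PAnn A) T V) :
    IsGLBIn (PAnn A) (Ann '' T) (Ann V) := by
  refine ⟨ann_mem_pAnn h.1, ?_, fun U hU hUT => subset_ann_comm.1 ?_⟩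
  · rintro _ ⟨W, hW, rfl⟩
    exact ann_anti (h.2.1 W hW)
  · exact h.2.2 _ (ann_mem_pAnn hU) fun W hW => subset_ann_comm.1 (hUT _ ⟨W, hW, rfl⟩)

theorem IsGLBIn.ann_image {T : Set (Set A)} (hT : T ⊆ PAnn A) {V : Set A}
    (h : IsGLBIn (PAnn A) T V) : IsLUBIn (PAnn A) (Ann '' T) (Ann V) := by
  refine ⟨ann_mem_pAnn h.1, ?_, fun U hU hUT => ?_⟩
  · rintro _ ⟨W, hW, rfl⟩
    exact ann_anti (h.2.1 W hW)
  · rw [← ann_ann_of_mem_pAnn hU]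
    refine ann_anti (h.2.2 _ (ann_mem_pAnn hU) fun W hW => ?_)
    rw [← ann_ann_of_mem_pAnn (hT hW)]
    exact ann_anti (hUT _ ⟨W, hW, rfl⟩)

theorem exists_isLUBIn {T : Set (Set A)} (hT : T ⊆ PAnn A) : ∃ V, IsLUBIn (PAnn A) T V := by
  have hT' : Ann '' T ⊆ PAnn A := by
    rintro _ ⟨W, hW, rfl⟩
    exact ann_mem_pAnn (hT hW)
  have himage : Ann '' (Ann '' T) = T := by
    rw [Set.image_image, Set.image_congr fun W hW => ann_ann_of_mem_pAnn (hT hW), Set.image_id']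
  exact ⟨_, himage ▸ (isGLBIn_sInter hT').ann_image hT'⟩

theorem star_mem_of_mem_pAnn {V : Set A} (hV : V ∈ PAnn A) {a : A} (ha : a ∈ V) :
    star a ∈ V := by
  obtain ⟨S, hS, rfl⟩ := mem_pAnn_iff.1 hV
  intro s hs
  have hself : star s = s := (IsSelfAdjoint.of_nonneg (hS s hs)).star_eq
  simpa [hself, add_comm] using congrArg star (ha s hs)

theorem isGLBIn_ann {V : Set A} (hV : V ∈ PAnn A) : IsGLBIn (PAnn A) {V, Ann V} {0} := by
  have hsub : ({V, Ann V} : Set (Set A)) ⊆ PAnn A := by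
    rintro _ (rfl | rfl)
    exacts [hV, ann_mem_pAnn hV]
  convert isGLBIn_sInter hsub using 1
  rw [Set.sInter_pair]
  refine Set.Subset.antisymm ?_ fun a ha => ?_
  · obtain ⟨S, -, rfl⟩ := hV
    simp [Ann]
  · exact eq_zero_of_mul_star_add_star_mul_eq_zero (ha.2 _ (star_mem_of_mem_pAnn hV ha.1))

theorem isLUBIn_ann {V : Set A} (hV : V ∈ PAnn A) :
    IsLUBIn (PAnn A) {V, Ann V} Set.univ := by
  have hsub : ({V, Ann V} : Set (Set A)) ⊆ PAnn A := by
    rintro _ (rfl | rfl)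
    exacts [hV, ann_mem_pAnn hV]
  have h := (isGLBIn_ann hV).ann_image hsub
  rwa [Set.image_pair, ann_ann_of_mem_pAnn hV, Set.pair_comm, ann_zero] at h

end CStar

/-- The complete lattice `𝒫` with zero `{0}`, unit `A` and
orthocomplementation `V ↦ Ann V` is an ortholattice. -/
theorem stmt_9 {A : Type*} [NonUnitalCStarAlgebra A] [PartialOrder A] [StarOrderedRing A] :
    ({0} : Set A) ∈ PAnn A ∧ (Set.univ : Set A) ∈ PAnn A ∧
    (∀ V ∈ PAnn A, ({0} : Set A) ⊆ V ∧ V ⊆ Set.univ) ∧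
    (∀ T ⊆ PAnn A, ∃ V, IsLUBIn (PAnn A) T V) ∧
    (∀ T ⊆ PAnn A, ∃ V, IsGLBIn (PAnn A) T V) ∧
    (∀ V ∈ PAnn A, Ann V ∈ PAnn A) ∧
    (∀ V ∈ PAnn A, IsGLBIn (PAnn A) {V, Ann V} {0} ∧ IsLUBIn (PAnn A) {V, Ann V} Set.univ) ∧
    (∀ V ∈ PAnn A, Ann (Ann V) = V) ∧
    (∀ V ∈ PAnn A, ∀ W ∈ PAnn A,
      (∀ Z, IsLUBIn (PAnn A) {V, W} Z → IsGLBIn (PAnn A) {Ann V, Ann W} (Ann Z)) ∧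
      (∀ Z, IsGLBIn (PAnn A) {V, W} Z → IsLUBIn (PAnn A) {Ann V, Ann W} (Ann Z))) := by
  refine ⟨zero_mem_pAnn, univ_mem_pAnn, fun V hV => ⟨?_, Set.subset_univ V⟩,
    fun _ hT => exists_isLUBIn hT, fun _ hT => ⟨_, isGLBIn_sInter hT⟩,
    fun _ hV => ann_mem_pAnn hV, fun _ hV => ⟨isGLBIn_ann hV, isLUBIn_ann hV⟩,
    fun _ hV => ann_ann_of_mem_pAnn hV, fun V hV W hW => ⟨fun Z hZ => ?_, fun Z hZ => ?_⟩⟩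
  · exact (isGLBIn_ann hV).2.1 V (Or.inl rfl)
  · exact Set.image_pair Ann V W ▸ hZ.ann_image
  · refine Set.image_pair Ann V W ▸ hZ.ann_image ?_
    rintro _ (rfl | rfl)
    exacts [hV, hW]
end
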